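/- (Claim 5) Let A₄'={x^{2_{[p̄]}}, t^{2_{[q̄]}} : p∈I_{1,3}, q∈I_{4,6}}, with A₄=A₄'∪{x^{−2_{[0]}}} if Γ₀≠{0} and A₄=A₄' if Γ₀={0}. If a derivation d of 𝒦 vanishes on A₁∪A₂∪A₃, then d vanishes on A₄. -/

import Mathlib

noncomputable section

/-- `ι_i = ℓ₁ + ⋯ + ℓ_i`. -/
def iot (ℓ : ℕ → ℕ) (i : ℕ) : ℕ := ∑ k ∈ Finset.Icc 1 i, ℓ k

/-- `I_{i,j} = {ι_{i-1}+1, …, ι_j}`. -/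
def iSet (ℓ : ℕ → ℕ) (i j : ℕ) : Finset ℕ := Finset.Icc (iot ℓ (i - 1) + 1) (iot ℓ j)

/-- The index-shift map `p ↦ p̄` (shift by `ι₆`). -/
def bar (ℓ : ℕ → ℕ) (p : ℕ) : ℕ := if p ≤ iot ℓ 6 then p + iot ℓ 6 else p - iot ℓ 6

/-- `K̄ = {p̄ : p ∈ K}`. -/
def barSet (ℓ : ℕ → ℕ) (K : Finset ℕ) : Finset ℕ := K.image (bar ℓ)

/-- `J_{i,j} = I_{i,j} ∪ Ī_{i,j}`. -/
def jSet (ℓ : ℕ → ℕ) (i j : ℕ) : Finset ℕ := iSet ℓ i j ∪ barSet ℓ (iSet ℓ i j)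

/-- The semigroup `𝒥 = 𝒥₀ × 𝒥₁`, encoded as functions `ℕ → ℕ`; `j0 = true`
means `𝒥₀ = ℕ` and `j0 = false` means `𝒥₀ = {0}`. -/
def jIdx (ℓ : ℕ → ℕ) (j0 : Bool) : Set (ℕ → ℕ) :=
  {i | (j0 = false → i 0 = 0) ∧
    ∀ p, 1 ≤ p →
      (p ∈ iSet ℓ 1 2 ∪ iSet ℓ 4 4 ∪ barSet ℓ (iSet ℓ 1 1) ∨ 2 * iot ℓ 6 < p) → i p = 0}

/-- `σ_p` (with `σ_p = σ_{p̄}`). -/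
def sgm (F : Type*) [Field F] (ℓ : ℕ → ℕ) (p : ℕ) : ℕ → F :=
  let q := if p ≤ iot ℓ 6 then p else p - iot ℓ 6
  if q ∈ iSet ℓ 1 3 then -Pi.single q (1 : F) - Pi.single (q + iot ℓ 6) (1 : F)
  else if q ∈ iSet ℓ 4 5 then -Pi.single q (1 : F)
  else 0

/-- The underlying space `𝒜`: the free `F`-module with basis `Γ × 𝒥`. -/
abbrev CA (F : Type*) [Field F] (ℓ : ℕ → ℕ) (Γ : AddSubgroup (ℕ → F)) (j0 : Bool) : Type _ :=
  (↥Γ × ↥(jIdx ℓ j0)) →₀ F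

/-- The basis monomial `x^{α,i⃗}`, with the convention that it is `0` if `(α,i⃗) ∉ Γ × 𝒥`. -/
def X (F : Type*) [Field F] (ℓ : ℕ → ℕ) (Γ : AddSubgroup (ℕ → F)) (j0 : Bool)
    (α : ℕ → F) (i : ℕ → ℕ) : CA F ℓ Γ j0 :=
  @dite _ (α ∈ Γ ∧ i ∈ jIdx ℓ j0) (Classical.dec _)
    (fun h => Finsupp.single (⟨α, h.1⟩, ⟨i, h.2⟩) 1) (fun _ => 0)

variable (F : Type*) [Field F] (ℓ : ℕ → ℕ) (Γ : AddSubgroup (ℕ → F)) (j0 : Bool)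

/-- The commutative associative product on `𝒜`. -/
def mulA (u v : CA F ℓ Γ j0) : CA F ℓ Γ j0 :=
  u.sum fun a ca => v.sum fun b cb =>
    (ca * cb) • X F ℓ Γ j0 (a.1.1 + b.1.1) (a.2.1 + b.2.1)

/-- The grading operator `∂*_p`. -/
def pstar (p : ℕ) (u : CA F ℓ Γ j0) : CA F ℓ Γ j0 :=
  u.sum fun a ca => (ca * a.1.1 p) • Finsupp.single a 1

/-- The down-grading operator `∂_{t_p}`. -/
def pt (p : ℕ) (u : CA F ℓ Γ j0) : CA F ℓ Γ j0 :=
  u.sum fun a ca => (ca * (a.2.1 p : F)) • X F ℓ Γ j0 a.1.1 (a.2.1 - Pi.single p 1)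

/-- `∂_p = ∂*_p + ∂_{t_p}`. -/
def dd (p : ℕ) (u : CA F ℓ Γ j0) : CA F ℓ Γ j0 := pstar F ℓ Γ j0 p u + pt F ℓ Γ j0 p u

/-- `∂ = Σ_{p∈J_{1,3}∪I_{4,5}} ∂*_p + Σ_{p∈I₆∪Ī_{4,6}} t_p ∂_{t_p}`. -/
def Dop (u : CA F ℓ Γ j0) : CA F ℓ Γ j0 :=
  (∑ p ∈ jSet ℓ 1 3 ∪ iSet ℓ 4 5, pstar F ℓ Γ j0 p u) +
    ∑ p ∈ iSet ℓ 6 6 ∪ barSet ℓ (iSet ℓ 4 6),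
      mulA F ℓ Γ j0 (X F ℓ Γ j0 0 (Pi.single p 1)) (pt F ℓ Γ j0 p u)

/-- The contact bracket (2.18):
`[u,v] = Σ_{p∈I} x^{σ_p}(∂_p u·∂_{p̄} v − ∂_{p̄} u·∂_p v) + (2−∂)(u)·∂₀(v) − ∂₀(u)·(2−∂)(v)`. -/
def brk (u v : CA F ℓ Γ j0) : CA F ℓ Γ j0 :=
  (∑ p ∈ iSet ℓ 1 6,
      mulA F ℓ Γ j0 (X F ℓ Γ j0 (sgm F ℓ p) 0)
        (mulA F ℓ Γ j0 (dd F ℓ Γ j0 p u) (dd F ℓ Γ j0 (bar ℓ p) v) -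
          mulA F ℓ Γ j0 (dd F ℓ Γ j0 (bar ℓ p) u) (dd F ℓ Γ j0 p v))) +
    mulA F ℓ Γ j0 ((2 : F) • u - Dop F ℓ Γ j0 u) (dd F ℓ Γ j0 0 v) -
    mulA F ℓ Γ j0 (dd F ℓ Γ j0 0 u) ((2 : F) • v - Dop F ℓ Γ j0 v)


/-- The set `A₁`: the ad-locally-finite but not ad-semisimple basis elements
(`x^{−σ_p}` for `p ∈ I_{2,3}`, `x^{−σ_q,1_{[q̄]}}` for `q ∈ I₅`, plus `1` if `𝒥₀ = ℕ`). -/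
def A1 (F : Type*) [Field F] (ℓ : ℕ → ℕ) (Γ : AddSubgroup (ℕ → F)) (j0 : Bool) :
    Set (CA F ℓ Γ j0) :=
  ((fun p => X F ℓ Γ j0 (-sgm F ℓ p) 0) '' ↑(iSet ℓ 2 3)) ∪
    ((fun q => X F ℓ Γ j0 (-sgm F ℓ q) (Pi.single (bar ℓ q) 1)) '' ↑(iSet ℓ 5 5)) ∪
    {y | j0 = true ∧ y = X F ℓ Γ j0 0 0}

/-- The set `A₂`: the ad-semisimple elements
(`x^{−σ_p}` for `p ∈ I₁`, `x^{−σ_q,1_{[q̄]}}` for `q ∈ I₄`, `t^{1_{[r]}+1_{[r̄]}}` for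
`r ∈ I₆`, plus `1` if `𝒥₀ = {0}`). -/
def A2 (F : Type*) [Field F] (ℓ : ℕ → ℕ) (Γ : AddSubgroup (ℕ → F)) (j0 : Bool) :
    Set (CA F ℓ Γ j0) :=
  ((fun p => X F ℓ Γ j0 (-sgm F ℓ p) 0) '' ↑(iSet ℓ 1 1)) ∪
    ((fun q => X F ℓ Γ j0 (-sgm F ℓ q) (Pi.single (bar ℓ q) 1)) '' ↑(iSet ℓ 4 4)) ∪
    ((fun r => X F ℓ Γ j0 0 (Pi.single r 1 + Pi.single (bar ℓ r) 1)) '' ↑(iSet ℓ 6 6)) ∪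
    {y | j0 = false ∧ y = X F ℓ Γ j0 0 0}

/-- The set `A₃`: `x^{2_{[p]}}` for `p ∈ I_{1,5}`, `t^{2_{[q]}}` for `q ∈ I₆`, plus
`x^{2_{[0]}}` if `Γ₀ ≠ {0}` or `t₀` if `Γ₀ = {0}`. -/
def A3 (F : Type*) [Field F] (ℓ : ℕ → ℕ) (Γ : AddSubgroup (ℕ → F)) (j0 : Bool) :
    Set (CA F ℓ Γ j0) :=
  ((fun p => X F ℓ Γ j0 (Pi.single p (2 : F)) 0) '' ↑(iSet ℓ 1 5)) ∪
    ((fun q => X F ℓ Γ j0 0 (Pi.single q 2)) '' ↑(iSet ℓ 6 6)) ∪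
    {y | ((∃ α ∈ Γ, α 0 ≠ 0) ∧ y = X F ℓ Γ j0 (Pi.single 0 (2 : F)) 0) ∨
      ((∀ α ∈ Γ, α 0 = 0) ∧ y = X F ℓ Γ j0 0 (Pi.single 0 1))}

/-- The set `A₄`: `x^{2_{[p̄]}}` for `p ∈ I_{1,3}`, `t^{2_{[q̄]}}` for `q ∈ I_{4,6}`, plus
`x^{−2_{[0]}}` if `Γ₀ ≠ {0}`. -/
def A4 (F : Type*) [Field F] (ℓ : ℕ → ℕ) (Γ : AddSubgroup (ℕ → F)) (j0 : Bool) :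
    Set (CA F ℓ Γ j0) :=
  ((fun p => X F ℓ Γ j0 (Pi.single (bar ℓ p) (2 : F)) 0) '' ↑(iSet ℓ 1 3)) ∪
    ((fun q => X F ℓ Γ j0 0 (Pi.single (bar ℓ q) 2)) '' ↑(iSet ℓ 4 6)) ∪
    {y | (∃ α ∈ Γ, α 0 ≠ 0) ∧ y = X F ℓ Γ j0 (Pi.single 0 (-2 : F)) 0}

section Helpers

variable {F ℓ Γ j0}

/-! ### Index sets -/

theorem iot_step (k : ℕ) : iot ℓ k ≤ iot ℓ (k + 1) := by
  unfold iot
  exact Finset.sum_le_sum_of_subset (Finset.Icc_subset_Icc_right (by omega))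

theorem iot_zero : iot ℓ 0 = 0 := by simp [iot]

theorem iot_chain : iot ℓ 0 = 0 ∧ iot ℓ 0 ≤ iot ℓ 1 ∧ iot ℓ 1 ≤ iot ℓ 2 ∧ iot ℓ 2 ≤ iot ℓ 3 ∧
    iot ℓ 3 ≤ iot ℓ 4 ∧ iot ℓ 4 ≤ iot ℓ 5 ∧ iot ℓ 5 ≤ iot ℓ 6 :=
  ⟨iot_zero, iot_step 0, iot_step 1, iot_step 2, iot_step 3, iot_step 4, iot_step 5⟩

theorem mem_iSet {i j p : ℕ} : p ∈ iSet ℓ i j ↔ iot ℓ (i - 1) + 1 ≤ p ∧ p ≤ iot ℓ j := by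
  simp [iSet]

theorem mem_barSet {i j p : ℕ} (hj : iot ℓ j ≤ iot ℓ 6) :
    p ∈ barSet ℓ (iSet ℓ i j) ↔
      iot ℓ 6 + iot ℓ (i - 1) + 1 ≤ p ∧ p ≤ iot ℓ 6 + iot ℓ j := by
  unfold barSet bar
  simp only [Finset.mem_image, mem_iSet]
  constructor
  · rintro ⟨q, hq, rfl⟩
    split_ifs <;> omega
  · intro h
    refine ⟨p - iot ℓ 6, by omega, ?_⟩
    rw [if_pos (by omega)]; omega

variable (ℓ) in
/-- Indices of group type. -/
def S1 : Finset ℕ := jSet ℓ 1 3 ∪ iSet ℓ 4 5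

variable (ℓ) in
/-- Indices of polynomial type. -/
def S2 : Finset ℕ := iSet ℓ 6 6 ∪ barSet ℓ (iSet ℓ 4 6)

theorem mem_S1 {p : ℕ} : p ∈ S1 ℓ ↔ (1 ≤ p ∧ p ≤ iot ℓ 5) ∨
    (iot ℓ 6 + 1 ≤ p ∧ p ≤ iot ℓ 6 + iot ℓ 3) := by
  have h := iot_chain (ℓ := ℓ)
  simp only [S1, jSet, Finset.mem_union, mem_iSet, mem_barSet (ℓ := ℓ) (i := 1) (j := 3) (by omega)]
  norm_num
  omega

theorem mem_S2 {p : ℕ} : p ∈ S2 ℓ ↔ (iot ℓ 5 + 1 ≤ p ∧ p ≤ iot ℓ 6) ∨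
    (iot ℓ 6 + iot ℓ 3 + 1 ≤ p ∧ p ≤ 2 * iot ℓ 6) := by
  have h := iot_chain (ℓ := ℓ)
  simp only [S2, Finset.mem_union, mem_iSet, mem_barSet (ℓ := ℓ) (i := 4) (j := 6) (by omega)]
  norm_num
  omega

theorem S1_disj : Disjoint (S1 ℓ) (S2 ℓ) := by
  have h := iot_chain (ℓ := ℓ)
  rw [Finset.disjoint_left]
  intro p
  rw [mem_S1, mem_S2]
  omega

theorem S1_union : S1 ℓ ∪ S2 ℓ = Finset.Icc 1 (2 * iot ℓ 6) := by
  have h := iot_chain (ℓ := ℓ)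
  ext p
  rw [Finset.mem_union, mem_S1, mem_S2, Finset.mem_Icc]
  omega

theorem bar_low {p : ℕ} (hp : p ≤ iot ℓ 6) : bar ℓ p = p + iot ℓ 6 := by simp [bar, hp]

/-! ### The exponent monoid -/

theorem jIdx_zero : (0 : ℕ → ℕ) ∈ jIdx ℓ j0 := by simp [jIdx]

theorem jIdx_add {i j : ℕ → ℕ} (hi : i ∈ jIdx ℓ j0) (hj : j ∈ jIdx ℓ j0) :
    i + j ∈ jIdx ℓ j0 := by
  refine ⟨fun h => ?_, fun p h1 h2 => ?_⟩
  · simp [hi.1 h, hj.1 h]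
  · simp [hi.2 p h1 h2, hj.2 p h1 h2]

theorem jIdx_sub {i : ℕ → ℕ} (hi : i ∈ jIdx ℓ j0) (j : ℕ → ℕ) : i - j ∈ jIdx ℓ j0 := by
  refine ⟨fun h => ?_, fun p h1 h2 => ?_⟩
  · simp [hi.1 h]
  · simp [hi.2 p h1 h2]

variable (F ℓ) in
/-- Group part of the weight of the index `p`. -/
def gg (p : ℕ) : ℕ → F := if p ∈ S1 ℓ then Pi.single p 1 else 0

variable (ℓ) in
/-- Polynomial part of the weight of the index `p`. -/
def tau (p : ℕ) : ℕ → ℕ := if p ∈ S1 ℓ then 0 else Pi.single p 1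

theorem tau_mem {p : ℕ} (hp : 1 ≤ p) (hp' : p ≤ 2 * iot ℓ 6) : tau ℓ p ∈ jIdx ℓ j0 := by
  have h := iot_chain (ℓ := ℓ)
  unfold tau
  split_ifs with h1
  · exact jIdx_zero
  · rw [mem_S1] at h1
    refine ⟨fun _ => ?_, fun q h2 h3 => ?_⟩
    · rw [Pi.single_eq_of_ne (by omega)]
    · rw [Pi.single_eq_of_ne]
      rintro rfl
      simp only [Finset.mem_union, mem_iSet,
        mem_barSet (ℓ := ℓ) (i := 1) (j := 1) (by omega)] at h3
      norm_num at h3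
      omega

theorem tau_S2 {p : ℕ} (hp : p ∈ S2 ℓ) : tau ℓ p = Pi.single p 1 := by
  have : p ∉ S1 ℓ := fun h => Finset.disjoint_left.1 S1_disj h hp
  simp [tau, this]

theorem tau_S1 {p : ℕ} (hp : p ∈ S1 ℓ) : tau ℓ p = 0 := by simp [tau, hp]

theorem gg_S1 {p : ℕ} (hp : p ∈ S1 ℓ) : gg F ℓ p = Pi.single p 1 := by simp [gg, hp]

theorem gg_S2 {p : ℕ} (hp : p ∉ S1 ℓ) : gg F ℓ p = 0 := by simp [gg, hp]

theorem gg_apply (a p : ℕ) : gg F ℓ a p = if p = a ∧ p ∈ S1 ℓ then 1 else 0 := by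
  unfold gg
  by_cases h : p = a
  · subst h; split_ifs <;> simp_all
  · split_ifs <;> simp_all

theorem tau_apply (a p : ℕ) : tau ℓ a p = if p = a ∧ p ∉ S1 ℓ then 1 else 0 := by
  unfold tau
  by_cases h : p = a
  · subst h; split_ifs <;> simp_all
  · split_ifs <;> simp_all

theorem sgm_eq {p : ℕ} (hp : 1 ≤ p) (hp' : p ≤ iot ℓ 6) :
    sgm F ℓ p = -(gg F ℓ p + gg F ℓ (bar ℓ p)) := by
  have h := iot_chain (ℓ := ℓ)
  simp only [sgm, if_pos hp', bar_low hp', gg, mem_S1, mem_iSet]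
  norm_num
  by_cases h3 : p ≤ iot ℓ 3
  · rw [if_pos (by omega), if_pos (by omega), if_pos (by omega)]; abel
  · rw [if_neg (by omega)]
    by_cases h5 : p ≤ iot ℓ 5
    · rw [if_pos (by omega), if_neg (by omega), if_pos (by omega)]; abel
    · rw [if_neg (by omega), if_neg (by omega), if_neg (by omega)]; abel

/-! ### The product -/

theorem X_mem {α : ℕ → F} {i : ℕ → ℕ} (hα : α ∈ Γ) (hi : i ∈ jIdx ℓ j0) :
    X F ℓ Γ j0 α i = Finsupp.single (⟨α, hα⟩, ⟨i, hi⟩) 1 := by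
  unfold X
  rw [dif_pos ⟨hα, hi⟩]

@[simp] theorem mulA_zero_left (v : CA F ℓ Γ j0) : mulA F ℓ Γ j0 0 v = 0 := by simp [mulA]

@[simp] theorem mulA_zero_right (v : CA F ℓ Γ j0) : mulA F ℓ Γ j0 v 0 = 0 := by simp [mulA]

theorem mulA_add_left (u u' v : CA F ℓ Γ j0) :
    mulA F ℓ Γ j0 (u + u') v = mulA F ℓ Γ j0 u v + mulA F ℓ Γ j0 u' v := by
  unfold mulA
  rw [Finsupp.sum_add_index']
  · simp
  · intro a b c
    simp only [add_mul, add_smul, Finsupp.sum_add]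

theorem mulA_add_right (u v v' : CA F ℓ Γ j0) :
    mulA F ℓ Γ j0 u (v + v') = mulA F ℓ Γ j0 u v + mulA F ℓ Γ j0 u v' := by
  unfold mulA
  rw [← Finsupp.sum_add]
  refine Finsupp.sum_congr fun a _ => ?_
  rw [Finsupp.sum_add_index']
  · simp
  · intro a b c
    simp only [mul_add, add_smul]

theorem mulA_smul_left (c : F) (u v : CA F ℓ Γ j0) :
    mulA F ℓ Γ j0 (c • u) v = c • mulA F ℓ Γ j0 u v := by
  unfold mulA
  rw [Finsupp.sum_smul_index' (by simp), Finsupp.smul_sum]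
  refine Finsupp.sum_congr fun a _ => ?_
  rw [Finsupp.smul_sum]
  refine Finsupp.sum_congr fun b _ => ?_
  rw [smul_smul, smul_eq_mul, mul_assoc]

theorem mulA_smul_right (c : F) (u v : CA F ℓ Γ j0) :
    mulA F ℓ Γ j0 u (c • v) = c • mulA F ℓ Γ j0 u v := by
  unfold mulA
  rw [Finsupp.smul_sum]
  refine Finsupp.sum_congr fun a _ => ?_
  rw [Finsupp.sum_smul_index' (by simp), Finsupp.smul_sum]
  refine Finsupp.sum_congr fun b _ => ?_
  rw [smul_smul, smul_eq_mul]
  ring_nf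

theorem mulA_neg_right (u v : CA F ℓ Γ j0) :
    mulA F ℓ Γ j0 u (-v) = -mulA F ℓ Γ j0 u v := by
  rw [← neg_one_smul F v, mulA_smul_right, neg_one_smul]

theorem mulA_sub_right (u v v' : CA F ℓ Γ j0) :
    mulA F ℓ Γ j0 u (v - v') = mulA F ℓ Γ j0 u v - mulA F ℓ Γ j0 u v' := by
  rw [sub_eq_add_neg, mulA_add_right, mulA_neg_right, sub_eq_add_neg]

theorem mulA_X_X {α β : ℕ → F} {i j : ℕ → ℕ} (hα : α ∈ Γ) (hi : i ∈ jIdx ℓ j0)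
    (hβ : β ∈ Γ) (hj : j ∈ jIdx ℓ j0) :
    mulA F ℓ Γ j0 (X F ℓ Γ j0 α i) (X F ℓ Γ j0 β j) = X F ℓ Γ j0 (α + β) (i + j) := by
  rw [X_mem hα hi, X_mem hβ hj]
  simp [mulA]

theorem CA_induction {P : CA F ℓ Γ j0 → Prop} (h0 : P 0) (ha : ∀ u v, P u → P v → P (u + v))
    (hX : ∀ (c : F) (α : ℕ → F) (i : ℕ → ℕ), α ∈ Γ → i ∈ jIdx ℓ j0 → P (c • X F ℓ Γ j0 α i))
    (u : CA F ℓ Γ j0) : P u := by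
  induction u using Finsupp.induction_linear with
  | zero => exact h0
  | add f g hf hg => exact ha f g hf hg
  | single a c =>
    have := hX c a.1.1 a.2.1 a.1.2 a.2.2
    rw [X_mem a.1.2 a.2.2] at this
    simpa using this

theorem mulA_assoc_X {α β : ℕ → F} {i j : ℕ → ℕ} (hα : α ∈ Γ) (hi : i ∈ jIdx ℓ j0)
    (hβ : β ∈ Γ) (hj : j ∈ jIdx ℓ j0) (v : CA F ℓ Γ j0) :
    mulA F ℓ Γ j0 (X F ℓ Γ j0 α i) (mulA F ℓ Γ j0 (X F ℓ Γ j0 β j) v) =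
      mulA F ℓ Γ j0 (X F ℓ Γ j0 (α + β) (i + j)) v := by
  induction v using CA_induction with
  | h0 => simp
  | ha u v hu hv => simp only [mulA_add_right, hu, hv]
  | hX c γ k hγ hk =>
    simp only [mulA_smul_right]
    rw [mulA_X_X hβ hj hγ hk, mulA_X_X hα hi (Γ.add_mem hβ hγ) (jIdx_add hj hk),
      mulA_X_X (Γ.add_mem hα hβ) (jIdx_add hi hj) hγ hk, add_assoc, add_assoc]

theorem mulA_one (v : CA F ℓ Γ j0) : mulA F ℓ Γ j0 (X F ℓ Γ j0 0 0) v = v := by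
  induction v using CA_induction with
  | h0 => simp
  | ha u v hu hv => simp only [mulA_add_right, hu, hv]
  | hX c γ k hγ hk =>
    rw [mulA_smul_right, mulA_X_X Γ.zero_mem jIdx_zero hγ hk, zero_add, zero_add]

theorem mulA_X_inj {α : ℕ → F} {i : ℕ → ℕ} (hα : α ∈ Γ) (hi : i ∈ jIdx ℓ j0)
    (v : CA F ℓ Γ j0) (hv : mulA F ℓ Γ j0 (X F ℓ Γ j0 α i) v = 0) : v = 0 := by
  let f : (↥Γ × ↥(jIdx ℓ j0)) → (↥Γ × ↥(jIdx ℓ j0)) := fun b =>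
    (⟨α + b.1.1, Γ.add_mem hα b.1.2⟩, ⟨i + b.2.1, jIdx_add hi b.2.2⟩)
  have hf : Function.Injective f := by
    rintro ⟨⟨a, ha⟩, ⟨b, hb⟩⟩ ⟨⟨a', ha'⟩, ⟨b', hb'⟩⟩ h
    simpa [f] using h
  have key : ∀ v : CA F ℓ Γ j0, mulA F ℓ Γ j0 (X F ℓ Γ j0 α i) v = Finsupp.mapDomain f v := by
    intro v
    induction v using CA_induction with
    | h0 => simp
    | ha u v hu hv => rw [mulA_add_right, hu, hv, Finsupp.mapDomain_add]
    | hX c γ k hγ hk =>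
      rw [mulA_smul_right, mulA_X_X hα hi hγ hk, Finsupp.mapDomain_smul, X_mem hγ hk,
        Finsupp.mapDomain_single, X_mem (Γ.add_mem hα hγ) (jIdx_add hi hk)]
  rw [key] at hv
  exact Finsupp.mapDomain_injective hf (by rw [hv, Finsupp.mapDomain_zero])

/-! ### The derivations -/

theorem pstar_X {α : ℕ → F} {i : ℕ → ℕ} (hα : α ∈ Γ) (hi : i ∈ jIdx ℓ j0) (p : ℕ) :
    pstar F ℓ Γ j0 p (X F ℓ Γ j0 α i) = α p • X F ℓ Γ j0 α i := by
  rw [X_mem hα hi, pstar, Finsupp.sum_single_index (by simp), one_mul]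

theorem pt_X {α : ℕ → F} {i : ℕ → ℕ} (hα : α ∈ Γ) (hi : i ∈ jIdx ℓ j0) (p : ℕ) :
    pt F ℓ Γ j0 p (X F ℓ Γ j0 α i) = (i p : F) • X F ℓ Γ j0 α (i - Pi.single p 1) := by
  rw [X_mem hα hi]
  simp [pt]

theorem pstar_apply (p : ℕ) (z : CA F ℓ Γ j0) (b : ↥Γ × ↥(jIdx ℓ j0)) :
    pstar F ℓ Γ j0 p z b = b.1.1 p * z b := by
  induction z using Finsupp.induction_linear with
  | zero => simp [pstar]
  | add f g hf hg =>
    have : pstar F ℓ Γ j0 p (f + g) = pstar F ℓ Γ j0 p f + pstar F ℓ Γ j0 p g := by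
      unfold pstar
      rw [Finsupp.sum_add_index'] <;> simp [add_mul]
    rw [this, Finsupp.add_apply, hf, hg, Finsupp.add_apply, mul_add]
  | single a c =>
    by_cases h : a = b
    · subst h; simp [pstar, mul_comm]
    · simp [pstar, h]

theorem pt_ne_zero (p : ℕ) (z : CA F ℓ Γ j0) (b : ↥Γ × ↥(jIdx ℓ j0))
    (h : pt F ℓ Γ j0 p z b ≠ 0) :
    ∃ a ∈ z.support, a.1 = b.1 ∧ a.2.1 p = b.2.1 p + 1 := by
  unfold pt at h
  rw [Finsupp.sum_apply] at h
  obtain ⟨a, ha, hne⟩ := Finset.exists_ne_zero_of_sum_ne_zero h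
  refine ⟨a, ha, ?_⟩
  beta_reduce at hne
  rw [X_mem a.1.2 (jIdx_sub a.2.2 _)] at hne
  simp only [Finsupp.smul_apply, smul_eq_mul, ne_eq, mul_eq_zero, not_or] at hne
  have hab : ((⟨a.1.1, a.1.2⟩, ⟨a.2.1 - Pi.single p 1, jIdx_sub a.2.2 _⟩) :
      ↥Γ × ↥(jIdx ℓ j0)) = b := by
    by_contra hc
    exact hne.2 (by classical rw [Finsupp.single_apply, if_neg hc])
  subst hab
  refine ⟨rfl, ?_⟩
  have : a.2.1 p ≠ 0 := fun h => hne.1.2 (by simp [h])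
  simp only [Pi.sub_apply, Pi.single_eq_same]
  omega

/-- An eigenvector of `∂_p` is an eigenvector of `∂*_p`. -/
theorem dd_eig {p : ℕ} {z : CA F ℓ Γ j0} {c : F} (h : dd F ℓ Γ j0 p z = c • z) :
    pstar F ℓ Γ j0 p z = c • z := by
  classical
  have key : ∀ b ∈ z.support, b.1.1 p = c := by
    by_contra hcon
    push Not at hcon
    obtain ⟨b0, hb0, hb0'⟩ := hcon
    obtain ⟨b, hb, hmax⟩ := Finset.exists_max_image (z.support.filter fun b => b.1.1 p ≠ c)
      (fun b => b.2.1 p) ⟨b0, by simp only [Finset.mem_filter]; exact ⟨hb0, hb0'⟩⟩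
    rw [Finset.mem_filter] at hb
    have h1 := DFunLike.congr_fun h b
    simp only [dd, Finsupp.add_apply, pstar_apply, Finsupp.smul_apply, smul_eq_mul] at h1
    have h2 : pt F ℓ Γ j0 p z b ≠ 0 := by
      intro h0
      rw [h0, add_zero] at h1
      exact hb.2 (mul_right_cancel₀ (Finsupp.mem_support_iff.1 hb.1) h1)
    obtain ⟨a, ha, ha1, ha2⟩ := pt_ne_zero p z b h2
    have := hmax a (by rw [Finset.mem_filter, ha1]; exact ⟨ha, hb.2⟩)
    omega
  ext b
  rw [pstar_apply, Finsupp.smul_apply, smul_eq_mul]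
  by_cases hb : b ∈ z.support
  · rw [key b hb]
  · rw [Finsupp.notMem_support_iff.1 hb]; simp

theorem Dop_eig {z : CA F ℓ Γ j0} (c : ℕ → F)
    (h1 : ∀ p ∈ S1 ℓ, pstar F ℓ Γ j0 p z = c p • z)
    (h2 : ∀ p ∈ S2 ℓ,
      mulA F ℓ Γ j0 (X F ℓ Γ j0 0 (Pi.single p 1)) (pt F ℓ Γ j0 p z) = c p • z) :
    Dop F ℓ Γ j0 z = (∑ p ∈ Finset.Icc 1 (2 * iot ℓ 6), c p) • z := by
  unfold Dop
  change (∑ p ∈ S1 ℓ, pstar F ℓ Γ j0 p z) + ∑ p ∈ S2 ℓ,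
      mulA F ℓ Γ j0 (X F ℓ Γ j0 0 (Pi.single p 1)) (pt F ℓ Γ j0 p z) = _
  rw [Finset.sum_congr rfl h1, Finset.sum_congr rfl h2, ← Finset.sum_smul, ← Finset.sum_smul,
    ← add_smul, ← Finset.sum_union S1_disj, S1_union]

theorem Dop_X {α : ℕ → F} {i : ℕ → ℕ} (hα : α ∈ Γ) (hi : i ∈ jIdx ℓ j0) :
    Dop F ℓ Γ j0 (X F ℓ Γ j0 α i) = (∑ p ∈ Finset.Icc 1 (2 * iot ℓ 6),
      if p ∈ S1 ℓ then α p else (i p : F)) • X F ℓ Γ j0 α i := by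
  refine Dop_eig _ (fun p hp => ?_) fun p hp => ?_
  · rw [pstar_X hα hi, if_pos hp]
  · rw [if_neg fun h => Finset.disjoint_left.1 S1_disj h hp, pt_X hα hi, mulA_smul_right]
    by_cases h0 : i p = 0
    · simp [h0]
    · have hm := mem_S2.1 hp
      have hc := iot_chain (ℓ := ℓ)
      rw [mulA_X_X Γ.zero_mem (by rw [← tau_S2 hp]; exact tau_mem (by omega) (by omega)) hα
        (jIdx_sub hi _), zero_add]
      congr 2
      ext q
      by_cases hq : q = p
      · subst hq; simp; omega
      · simp [hq]

theorem brk_zero_left (v : CA F ℓ Γ j0) : brk F ℓ Γ j0 0 v = 0 := by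
  have h1 : ∀ p, dd F ℓ Γ j0 p 0 = 0 := fun p => by simp [dd, pstar, pt]
  have h2 : Dop F ℓ Γ j0 0 = 0 := by simp [Dop, pstar, pt]
  simp [brk, h1, h2]

/-! ### Quadratic elements -/

variable (F ℓ Γ j0) in
/-- The quadratic monomial with indices `a`, `b`. -/
def QQ (a b : ℕ) : CA F ℓ Γ j0 := X F ℓ Γ j0 (gg F ℓ a + gg F ℓ b) (tau ℓ a + tau ℓ b)

theorem gg_mem (hΓ1 : ∀ p ∈ S1 ℓ, (Pi.single p (1 : F) : ℕ → F) ∈ Γ) (p : ℕ) :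
    gg F ℓ p ∈ Γ := by
  unfold gg
  split_ifs with h
  · exact hΓ1 p h
  · exact Γ.zero_mem

theorem Dop_QQ (hΓ1 : ∀ p ∈ S1 ℓ, (Pi.single p (1 : F) : ℕ → F) ∈ Γ) {a b : ℕ}
    (ha : a ∈ Finset.Icc 1 (2 * iot ℓ 6)) (hb : b ∈ Finset.Icc 1 (2 * iot ℓ 6)) :
    Dop F ℓ Γ j0 (QQ F ℓ Γ j0 a b) = (2 : F) • QQ F ℓ Γ j0 a b := by
  have ha' := Finset.mem_Icc.1 ha
  have hb' := Finset.mem_Icc.1 hb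
  unfold QQ
  rw [Dop_X (Γ.add_mem (gg_mem hΓ1 a) (gg_mem hΓ1 b))
    (jIdx_add (tau_mem ha'.1 ha'.2) (tau_mem hb'.1 hb'.2))]
  congr 1
  have : ∀ p ∈ Finset.Icc 1 (2 * iot ℓ 6), (if p ∈ S1 ℓ then (gg F ℓ a + gg F ℓ b) p else
      (((tau ℓ a + tau ℓ b) p : ℕ) : F)) = (if p = a then 1 else 0) + if p = b then 1 else 0 := by
    intro p _
    simp only [Pi.add_apply, gg_apply, tau_apply]
    split_ifs <;> simp_all [one_add_one_eq_two]
  rw [Finset.sum_congr rfl this, Finset.sum_add_distrib, Finset.sum_ite_eq', Finset.sum_ite_eq',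
    if_pos ha, if_pos hb]
  norm_num

theorem dd_QQ (hΓ1 : ∀ p ∈ S1 ℓ, (Pi.single p (1 : F) : ℕ → F) ∈ Γ) {a b : ℕ}
    (ha : a ∈ Finset.Icc 1 (2 * iot ℓ 6)) (hb : b ∈ Finset.Icc 1 (2 * iot ℓ 6)) (c : ℕ) :
    dd F ℓ Γ j0 c (QQ F ℓ Γ j0 a b) =
      (if c = a then X F ℓ Γ j0 (gg F ℓ a + gg F ℓ b) (tau ℓ b) else 0) +
      (if c = b then X F ℓ Γ j0 (gg F ℓ a + gg F ℓ b) (tau ℓ a) else 0) := by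
  have ha' := Finset.mem_Icc.1 ha
  have hb' := Finset.mem_Icc.1 hb
  have hg := Γ.add_mem (gg_mem hΓ1 a) (gg_mem hΓ1 b)
  have ht := jIdx_add (j0 := j0) (tau_mem ha'.1 ha'.2) (tau_mem hb'.1 hb'.2)
  unfold dd QQ
  rw [pstar_X hg ht, pt_X hg ht]
  simp only [Pi.add_apply, gg_apply, tau_apply]
  by_cases hc : c ∈ S1 ℓ
  · by_cases h1 : c = a
    · by_cases h2 : c = b
      · subst h1; subst h2
        simp [hc, tau_S1 hc, add_smul]
      · subst h1
        simp [hc, tau_S1 hc, h2]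
    · by_cases h2 : c = b
      · subst h2
        simp [hc, tau_S1 hc, h1]
      · simp [h1, h2]
  · have ht' : tau ℓ c = Pi.single c 1 := by simp [tau, hc]
    by_cases h1 : c = a
    · by_cases h2 : c = b
      · subst h1; subst h2
        simp [hc, ht', one_add_one_eq_two, two_smul]
      · subst h1
        simp [hc, ht', h2]
    · by_cases h2 : c = b
      · subst h2
        simp [hc, ht', h1]
      · simp [h1, h2]

theorem brk_QQ (hΓ1 : ∀ p ∈ S1 ℓ, (Pi.single p (1 : F) : ℕ → F) ∈ Γ) {p b : ℕ}
    (hp : 1 ≤ p) (hp' : p ≤ iot ℓ 6) (hb : b = p ∨ b = bar ℓ p) (z : CA F ℓ Γ j0) :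
    brk F ℓ Γ j0 (QQ F ℓ Γ j0 p b) z =
      mulA F ℓ Γ j0 (X F ℓ Γ j0 (sgm F ℓ p) 0)
        (mulA F ℓ Γ j0 (dd F ℓ Γ j0 p (QQ F ℓ Γ j0 p b)) (dd F ℓ Γ j0 (bar ℓ p) z) -
          mulA F ℓ Γ j0 (dd F ℓ Γ j0 (bar ℓ p) (QQ F ℓ Γ j0 p b)) (dd F ℓ Γ j0 p z)) := by
  have hc := iot_chain (ℓ := ℓ)
  have hbar := bar_low hp'
  have hpm : p ∈ Finset.Icc 1 (2 * iot ℓ 6) := by rw [Finset.mem_Icc]; omega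
  have hbm : b ∈ Finset.Icc 1 (2 * iot ℓ 6) := by rw [Finset.mem_Icc]; omega
  have h0 : dd F ℓ Γ j0 0 (QQ F ℓ Γ j0 p b) = 0 := by
    rw [dd_QQ hΓ1 hpm hbm, if_neg (by omega), if_neg (by omega), add_zero]
  have hz : ∀ q, q ≠ p → q ≠ bar ℓ p → dd F ℓ Γ j0 q (QQ F ℓ Γ j0 p b) = 0 := by
    intro q h1 h2
    rw [dd_QQ hΓ1 hpm hbm, if_neg (by omega), if_neg (by omega), add_zero]
  unfold brk
  rw [h0, Dop_QQ hΓ1 hpm hbm, sub_self, mulA_zero_left, mulA_zero_left, add_zero, sub_zero]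
  rw [Finset.sum_eq_single p]
  · intro q hq hqp
    rw [mem_iSet] at hq
    have hq' := bar_low hq.2
    rw [hz q hqp (by omega), hz (bar ℓ q) (by omega) (by omega)]
    simp
  · intro h
    exact absurd (mem_iSet.2 (by norm_num; omega)) h

/-- The Cartan-type elements. -/
theorem brk_w (hΓ1 : ∀ p ∈ S1 ℓ, (Pi.single p (1 : F) : ℕ → F) ∈ Γ) {p : ℕ}
    (hp : 1 ≤ p) (hp' : p ≤ iot ℓ 6) (z : CA F ℓ Γ j0) :
    brk F ℓ Γ j0 (QQ F ℓ Γ j0 p (bar ℓ p)) z =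
      mulA F ℓ Γ j0 (X F ℓ Γ j0 0 (tau ℓ (bar ℓ p))) (dd F ℓ Γ j0 (bar ℓ p) z) -
      mulA F ℓ Γ j0 (X F ℓ Γ j0 0 (tau ℓ p)) (dd F ℓ Γ j0 p z) := by
  have hbar := bar_low hp'
  have hpm : p ∈ Finset.Icc 1 (2 * iot ℓ 6) := by rw [Finset.mem_Icc]; omega
  have hbm : bar ℓ p ∈ Finset.Icc 1 (2 * iot ℓ 6) := by rw [Finset.mem_Icc]; omega
  have hg := Γ.add_mem (gg_mem hΓ1 p) (gg_mem hΓ1 (bar ℓ p))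
  rw [brk_QQ hΓ1 hp hp' (Or.inr rfl), dd_QQ hΓ1 hpm hbm, dd_QQ hΓ1 hpm hbm, if_pos rfl,
    if_neg (by omega), if_neg (by omega), if_pos rfl, zero_add, add_zero, sgm_eq hp hp',
    mulA_sub_right, mulA_assoc_X (Γ.neg_mem hg) jIdx_zero hg (tau_mem (by omega) (by omega)),
    mulA_assoc_X (Γ.neg_mem hg) jIdx_zero hg (tau_mem (by omega) (by omega)),
    neg_add_cancel, zero_add, zero_add]

/-- The raising elements. -/
theorem brk_a (hΓ1 : ∀ p ∈ S1 ℓ, (Pi.single p (1 : F) : ℕ → F) ∈ Γ) {p : ℕ}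
    (hp : 1 ≤ p) (hp' : p ≤ iot ℓ 6) (z : CA F ℓ Γ j0) :
    brk F ℓ Γ j0 (QQ F ℓ Γ j0 p p) z =
      (2 : F) • mulA F ℓ Γ j0 (X F ℓ Γ j0 (gg F ℓ p - gg F ℓ (bar ℓ p)) (tau ℓ p))
        (dd F ℓ Γ j0 (bar ℓ p) z) := by
  have hbar := bar_low hp'
  have hpm : p ∈ Finset.Icc 1 (2 * iot ℓ 6) := by rw [Finset.mem_Icc]; omega
  have hg := Γ.add_mem (gg_mem hΓ1 p) (gg_mem hΓ1 (bar ℓ p))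
  rw [brk_QQ hΓ1 hp hp' (Or.inl rfl), dd_QQ hΓ1 hpm hpm, dd_QQ hΓ1 hpm hpm, if_pos rfl,
    if_neg (by omega), zero_add, mulA_zero_left, sub_zero, ← two_smul F, mulA_smul_left,
    mulA_smul_right, sgm_eq hp hp', mulA_assoc_X (Γ.neg_mem hg) jIdx_zero
      (Γ.add_mem (gg_mem hΓ1 p) (gg_mem hΓ1 p)) (tau_mem (by omega) (by omega)), zero_add]
  congr 4
  abel

/-- A monomial with only a `0`-component. -/
theorem brk_zero_mono {α : ℕ → F} {i : ℕ → ℕ} (hα : α ∈ Γ) (hi : i ∈ jIdx ℓ j0)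
    (hα0 : ∀ p, p ≠ 0 → α p = 0) (hi0 : ∀ p, p ≠ 0 → i p = 0) (z : CA F ℓ Γ j0) :
    brk F ℓ Γ j0 (X F ℓ Γ j0 α i) z =
      (2 : F) • mulA F ℓ Γ j0 (X F ℓ Γ j0 α i) (dd F ℓ Γ j0 0 z) -
      mulA F ℓ Γ j0 (dd F ℓ Γ j0 0 (X F ℓ Γ j0 α i)) ((2 : F) • z - Dop F ℓ Γ j0 z) := by
  have hz : ∀ p, p ≠ 0 → dd F ℓ Γ j0 p (X F ℓ Γ j0 α i) = 0 := by
    intro p hp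
    rw [dd, pstar_X hα hi, pt_X hα hi, hα0 p hp, hi0 p hp]
    simp
  have hD : Dop F ℓ Γ j0 (X F ℓ Γ j0 α i) = 0 := by
    rw [Dop_X hα hi, Finset.sum_eq_zero, zero_smul]
    intro p hp
    rw [Finset.mem_Icc] at hp
    rw [hα0 p (by omega), hi0 p (by omega)]
    simp
  unfold brk
  rw [hD, sub_zero, mulA_smul_left, Finset.sum_eq_zero, zero_add]
  intro p hp
  rw [mem_iSet] at hp
  have := bar_low hp.2
  rw [hz p (by omega), hz (bar ℓ p) (by omega)]
  simp

/-- Degree computation for a common eigenvector killed by the raising elements. -/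
theorem Dop_of_eig [CharZero F] (hΓ1 : ∀ p ∈ S1 ℓ, (Pi.single p (1 : F) : ℕ → F) ∈ Γ)
    (hΓ2 : ∀ α ∈ Γ, ∀ p ∈ S2 ℓ, α p = 0) (z : CA F ℓ Γ j0) (c : ℕ → F)
    (ha : ∀ p, 1 ≤ p → p ≤ iot ℓ 6 → brk F ℓ Γ j0 (QQ F ℓ Γ j0 p p) z = 0)
    (hw : ∀ p, 1 ≤ p → p ≤ iot ℓ 6 →
      brk F ℓ Γ j0 (QQ F ℓ Γ j0 p (bar ℓ p)) z = -(c p • z))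
    (hc : ∀ p, iot ℓ 6 < p → c p = 0) :
    Dop F ℓ Γ j0 z = (∑ p ∈ Finset.Icc 1 (2 * iot ℓ 6), c p) • z := by
  have h1 : ∀ p, 1 ≤ p → p ≤ iot ℓ 6 → dd F ℓ Γ j0 (bar ℓ p) z = 0 := by
    intro p hp hp'
    have h := ha p hp hp'
    rw [brk_a hΓ1 hp hp', smul_eq_zero] at h
    exact mulA_X_inj (Γ.sub_mem (gg_mem hΓ1 _) (gg_mem hΓ1 _)) (tau_mem hp (by omega)) _
      (h.resolve_left two_ne_zero)
  have h2 : ∀ p, 1 ≤ p → p ≤ 2 * iot ℓ 6 →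
      mulA F ℓ Γ j0 (X F ℓ Γ j0 0 (tau ℓ p)) (dd F ℓ Γ j0 p z) = c p • z := by
    intro p hp hp'
    by_cases hq : p ≤ iot ℓ 6
    · have h := hw p hp hq
      rw [brk_w hΓ1 hp hq, h1 p hp hq, mulA_zero_right, zero_sub, neg_inj] at h
      exact h
    · have h := h1 (p - iot ℓ 6) (by omega) (by omega)
      rw [bar_low (by omega), Nat.sub_add_cancel (by omega)] at h
      rw [h, mulA_zero_right, hc p (by omega), zero_smul]
  have hS : ∀ p, p ∈ S1 ℓ ∪ S2 ℓ → 1 ≤ p ∧ p ≤ 2 * iot ℓ 6 := by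
    intro p hp
    rw [S1_union] at hp
    exact Finset.mem_Icc.1 hp
  refine Dop_eig c (fun p hp => ?_) fun p hp => ?_
  · have hb := hS p (Finset.mem_union_left _ hp)
    have h := h2 p hb.1 hb.2
    rw [tau_S1 hp, mulA_one] at h
    exact dd_eig h
  · have hb := hS p (Finset.mem_union_right _ hp)
    have h := h2 p hb.1 hb.2
    have h0 : pstar F ℓ Γ j0 p z = 0 := by
      ext b
      rw [pstar_apply, hΓ2 _ b.1.2 p hp]
      simp
    rw [tau_S2 hp, dd, h0, zero_add] at h
    exact h

theorem single_two_eq {M : Type*} [AddMonoidWithOne M] (p : ℕ) :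
    (Pi.single p (2 : M) : ℕ → M) = Pi.single p 1 + Pi.single p 1 := by
  rw [← Pi.single_add, one_add_one_eq_two]

theorem w_mem {p : ℕ} (hp : 1 ≤ p) (hp' : p ≤ iot ℓ 6) :
    QQ F ℓ Γ j0 p (bar ℓ p) ∈ A1 F ℓ Γ j0 ∪ A2 F ℓ Γ j0 ∪ A3 F ℓ Γ j0 := by
  have hc := iot_chain (ℓ := ℓ)
  have hb := bar_low hp'
  have hs : -sgm F ℓ p = gg F ℓ p + gg F ℓ (bar ℓ p) := by rw [sgm_eq hp hp', neg_neg]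
  left
  by_cases h3 : p ≤ iot ℓ 3
  · have ht : tau ℓ p + tau ℓ (bar ℓ p) = 0 := by
      rw [tau_S1 (mem_S1.2 (by omega)), tau_S1 (mem_S1.2 (by omega)), add_zero]
    by_cases h1 : p ≤ iot ℓ 1
    · exact Or.inr (Or.inl (Or.inl (Or.inl ⟨p, Finset.mem_coe.2 (mem_iSet.2 (by norm_num; omega)), by
        simp only [QQ, ht, hs]⟩)))
    · exact Or.inl (Or.inl (Or.inl ⟨p, Finset.mem_coe.2 (mem_iSet.2 (by norm_num; omega)), by
        simp only [QQ, ht, hs]⟩))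
  · have htb : tau ℓ (bar ℓ p) = Pi.single (bar ℓ p) 1 := tau_S2 (mem_S2.2 (by omega))
    by_cases h5 : p ≤ iot ℓ 5
    · have ht : tau ℓ p + tau ℓ (bar ℓ p) = Pi.single (bar ℓ p) 1 := by
        rw [tau_S1 (mem_S1.2 (by omega)), htb, zero_add]
      by_cases h4 : p ≤ iot ℓ 4
      · exact Or.inr (Or.inl (Or.inl (Or.inr ⟨p, Finset.mem_coe.2 (mem_iSet.2 (by norm_num; omega)), by
          simp only [QQ, ht, hs]⟩)))
      · exact Or.inl (Or.inl (Or.inr ⟨p, Finset.mem_coe.2 (mem_iSet.2 (by norm_num; omega)), by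
          simp only [QQ, ht, hs]⟩))
    · have ht : tau ℓ p = Pi.single p 1 := tau_S2 (mem_S2.2 (by omega))
      have hg : gg F ℓ p + gg F ℓ (bar ℓ p) = 0 := by
        rw [gg_S2 (by rw [mem_S1]; omega), gg_S2 (by rw [mem_S1]; omega), add_zero]
      exact Or.inr (Or.inl (Or.inr ⟨p, Finset.mem_coe.2 (mem_iSet.2 (by norm_num; omega)), by
          simp only [QQ, ht, htb, hg]⟩))

theorem a_mem {p : ℕ} (hp : 1 ≤ p) (hp' : p ≤ iot ℓ 6) :
    QQ F ℓ Γ j0 p p ∈ A1 F ℓ Γ j0 ∪ A2 F ℓ Γ j0 ∪ A3 F ℓ Γ j0 := by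
  have hc := iot_chain (ℓ := ℓ)
  right
  left
  by_cases h5 : p ≤ iot ℓ 5
  · exact Or.inl ⟨p, Finset.mem_coe.2 (mem_iSet.2 (by norm_num; omega)), by
      simp only [QQ, tau_S1 (mem_S1.2 (Or.inl ⟨hp, h5⟩)), gg_S1 (mem_S1.2 (Or.inl ⟨hp, h5⟩)),
        single_two_eq, add_zero]⟩
  · exact Or.inr ⟨p, Finset.mem_coe.2 (mem_iSet.2 (by norm_num; omega)), by
      simp only [QQ, tau_S2 (mem_S2.2 (Or.inl ⟨by omega, hp'⟩)),
        gg_S2 (F := F) (ℓ := ℓ) (p := p) (by rw [mem_S1]; omega), single_two_eq, add_zero]⟩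

theorem A4_cases {y : CA F ℓ Γ j0} (hy : y ∈ A4 F ℓ Γ j0) :
    (∃ p, 1 ≤ p ∧ p ≤ iot ℓ 6 ∧ y = QQ F ℓ Γ j0 (bar ℓ p) (bar ℓ p)) ∨
      ((∃ α ∈ Γ, α 0 ≠ 0) ∧ y = X F ℓ Γ j0 (Pi.single 0 (-2 : F)) 0) := by
  have hc := iot_chain (ℓ := ℓ)
  rcases hy with (⟨p, hp, rfl⟩ | ⟨p, hp, rfl⟩) | hy
  · have hp := mem_iSet.1 (Finset.mem_coe.1 hp)
    norm_num at hp
    have hb := bar_low (ℓ := ℓ) (p := p) (by omega)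
    have hs : bar ℓ p ∈ S1 ℓ := mem_S1.2 (by omega)
    refine Or.inl ⟨p, by omega, by omega, ?_⟩
    simp only [QQ, tau_S1 hs, gg_S1 hs, single_two_eq, add_zero]
  · have hp := mem_iSet.1 (Finset.mem_coe.1 hp)
    norm_num at hp
    have hb := bar_low (ℓ := ℓ) (p := p) (by omega)
    have hs : bar ℓ p ∈ S2 ℓ := mem_S2.2 (by omega)
    refine Or.inl ⟨p, by omega, by omega, ?_⟩
    simp only [QQ, tau_S2 hs, gg_S2 (F := F) (fun h => Finset.disjoint_left.1 S1_disj h hs),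
      single_two_eq, add_zero]
  · exact Or.inr hy

theorem one_mem : X F ℓ Γ j0 0 0 ∈ A1 F ℓ Γ j0 ∪ A2 F ℓ Γ j0 ∪ A3 F ℓ Γ j0 := by
  cases j0 with
  | true => exact Or.inl (Or.inl (Or.inr ⟨rfl, rfl⟩))
  | false => exact Or.inl (Or.inr (Or.inr ⟨rfl, rfl⟩))

theorem dd_zero_X0 : dd F ℓ Γ j0 0 (X F ℓ Γ j0 0 0) = 0 := by
  rw [dd, pstar_X Γ.zero_mem jIdx_zero, pt_X Γ.zero_mem jIdx_zero]
  simp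

theorem brk_one (z : CA F ℓ Γ j0) :
    brk F ℓ Γ j0 (X F ℓ Γ j0 0 0) z = (2 : F) • dd F ℓ Γ j0 0 z := by
  rw [brk_zero_mono Γ.zero_mem jIdx_zero (by simp) (by simp), dd_zero_X0, mulA_zero_left,
    mulA_one, sub_zero]

theorem brk_x0 (h0 : (Pi.single 0 (2 : F) : ℕ → F) ∈ Γ) (z : CA F ℓ Γ j0) :
    brk F ℓ Γ j0 (X F ℓ Γ j0 (Pi.single 0 (2 : F)) 0) z =
      (2 : F) • mulA F ℓ Γ j0 (X F ℓ Γ j0 (Pi.single 0 (2 : F)) 0)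
        (dd F ℓ Γ j0 0 z - ((2 : F) • z - Dop F ℓ Γ j0 z)) := by
  rw [brk_zero_mono h0 jIdx_zero (fun p hp => by simp [hp]) (by simp),
    mulA_sub_right _ (dd F ℓ Γ j0 0 z), smul_sub]
  congr 1
  rw [dd, pstar_X h0 jIdx_zero, pt_X h0 jIdx_zero]
  simp [mulA_smul_left]

end Helpers

/-- **Claim 5.** If a derivation `d` of `𝒦` vanishes on `A₁ ∪ A₂ ∪ A₃`, then
`d` vanishes on `A₄`. -/
theorem derivation_vanishes_on_A4
    {F : Type*} [Field F] [CharZero F] (ℓ : ℕ → ℕ) (Γ : AddSubgroup (ℕ → F)) (j0 : Bool)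
    (hℓ : 0 < iot ℓ 6)
    (hΓ1 : ∀ p ∈ jSet ℓ 1 3 ∪ iSet ℓ 4 5, (Pi.single p (1 : F) : ℕ → F) ∈ Γ)
    (hΓ2 : ∀ α ∈ Γ, ∀ p ∈ iSet ℓ 6 6 ∪ barSet ℓ (iSet ℓ 4 6), α p = 0)
    (hΓ3 : ∀ α ∈ Γ, ∀ p, 2 * iot ℓ 6 < p → α p = 0)
    (hΓ0 : (∃ α ∈ Γ, α 0 ≠ 0) → (Pi.single 0 (1 : F) : ℕ → F) ∈ Γ)
    (hJ0 : j0 = false → ∃ α ∈ Γ, α 0 ≠ 0)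
    (d : CA F ℓ Γ j0 →ₗ[F] CA F ℓ Γ j0)
    (hd : ∀ u v : CA F ℓ Γ j0,
      d (brk F ℓ Γ j0 u v) = brk F ℓ Γ j0 (d u) v + brk F ℓ Γ j0 u (d v))
    (hvan : ∀ y ∈ A1 F ℓ Γ j0 ∪ A2 F ℓ Γ j0 ∪ A3 F ℓ Γ j0, d y = 0) :
    ∀ y ∈ A4 F ℓ Γ j0, d y = 0 := by
  change ∀ p ∈ S1 ℓ, (Pi.single p (1 : F) : ℕ → F) ∈ Γ at hΓ1
  change ∀ α ∈ Γ, ∀ p ∈ S2 ℓ, α p = 0 at hΓ2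
  have hn : ∀ a ∈ A1 F ℓ Γ j0 ∪ A2 F ℓ Γ j0 ∪ A3 F ℓ Γ j0, ∀ y,
      brk F ℓ Γ j0 a (d y) = d (brk F ℓ Γ j0 a y) := by
    intro a ha y
    rw [hd, hvan a ha, brk_zero_left, zero_add]
  have h20 : (∃ α ∈ Γ, α 0 ≠ 0) → (Pi.single 0 (2 : F) : ℕ → F) ∈ Γ := by
    intro h
    rw [single_two_eq]
    exact Γ.add_mem (hΓ0 h) (hΓ0 h)
  have h2F : (2 : F) ≠ 0 := two_ne_zero
  intro y hy
  rcases A4_cases hy with ⟨p, hp, hp', rfl⟩ | ⟨hG, rfl⟩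
  · have hbar := bar_low hp'
    have hbm : bar ℓ p ∈ Finset.Icc 1 (2 * iot ℓ 6) := by rw [Finset.mem_Icc]; omega
    have hbt : tau ℓ (bar ℓ p) ∈ jIdx ℓ j0 := tau_mem (by omega) (by omega)
    have hgb := gg_mem hΓ1 (bar ℓ p)
    set y := QQ F ℓ Γ j0 (bar ℓ p) (bar ℓ p) with hydef
    have hdd : ∀ q, q ≠ bar ℓ p → dd F ℓ Γ j0 q y = 0 := by
      intro q hq
      rw [hydef, dd_QQ hΓ1 hbm hbm, if_neg hq, add_zero]
    have hddb : dd F ℓ Γ j0 (bar ℓ p) y = (2 : F) •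
        X F ℓ Γ j0 (gg F ℓ (bar ℓ p) + gg F ℓ (bar ℓ p)) (tau ℓ (bar ℓ p)) := by
      rw [hydef, dd_QQ hΓ1 hbm hbm, if_pos rfl, two_smul]
    have hDy : Dop F ℓ Γ j0 y = (2 : F) • y := Dop_QQ hΓ1 hbm hbm
    have ha : ∀ q, 1 ≤ q → q ≤ iot ℓ 6 → brk F ℓ Γ j0 (QQ F ℓ Γ j0 q q) (d y) = 0 := by
      intro q hq hq'
      have hbq := bar_low hq'
      rw [hn _ (a_mem hq hq'), brk_a hΓ1 hq hq']
      by_cases hqp : q = p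
      · subst hqp
        rw [hddb, mulA_smul_right, mulA_X_X (Γ.sub_mem (gg_mem hΓ1 _) hgb)
          (tau_mem (by omega) (by omega)) (Γ.add_mem hgb hgb) hbt]
        have hw0 := hvan _ (w_mem (F := F) (Γ := Γ) (j0 := j0) hq hq')
        unfold QQ at hw0
        rw [show gg F ℓ q - gg F ℓ (bar ℓ q) + (gg F ℓ (bar ℓ q) + gg F ℓ (bar ℓ q)) =
          gg F ℓ q + gg F ℓ (bar ℓ q) by abel, map_smul, map_smul, hw0, smul_zero, smul_zero]
      · rw [hdd (bar ℓ q) (by omega), mulA_zero_right, smul_zero, map_zero]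
    have hw : ∀ q, 1 ≤ q → q ≤ iot ℓ 6 → brk F ℓ Γ j0 (QQ F ℓ Γ j0 q (bar ℓ q)) (d y) =
        -((if q = p then (-2 : F) else 0) • d y) := by
      intro q hq hq'
      have hbq := bar_low hq'
      rw [hn _ (w_mem hq hq'), brk_w hΓ1 hq hq', hdd q (by omega), mulA_zero_right, sub_zero]
      by_cases hqp : q = p
      · subst hqp
        rw [hddb, mulA_smul_right, mulA_X_X Γ.zero_mem hbt (Γ.add_mem hgb hgb) hbt, zero_add,
          if_pos rfl, neg_smul, neg_neg, map_smul]
        rfl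
      · rw [hdd (bar ℓ q) (by omega), mulA_zero_right, map_zero, if_neg hqp, zero_smul, neg_zero]
    have hD := Dop_of_eig hΓ1 hΓ2 (d y) (fun q => if q = p then (-2 : F) else 0) ha hw
      (fun q hq => if_neg (by omega))
    rw [Finset.sum_ite_eq', if_pos (by rw [Finset.mem_Icc]; omega)] at hD
    have hd0 : dd F ℓ Γ j0 0 (d y) = 0 := by
      have h := hn _ one_mem y
      rw [brk_one, brk_one, hdd 0 (by omega), smul_zero, map_zero, smul_eq_zero] at h
      exact h.resolve_left h2F
    have hfin : (2 : F) • d y - Dop F ℓ Γ j0 (d y) = 0 := by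
      by_cases hG : ∃ α ∈ Γ, α 0 ≠ 0
      · have h := hn (X F ℓ Γ j0 (Pi.single 0 (2 : F)) 0) (Or.inr (Or.inr (Or.inl ⟨hG, rfl⟩))) y
        rw [brk_x0 (h20 hG), brk_x0 (h20 hG), hd0, hdd 0 (by omega), hDy, sub_self, sub_zero,
          mulA_zero_right, smul_zero, map_zero, smul_eq_zero] at h
        have h := mulA_X_inj (h20 hG) jIdx_zero _ (h.resolve_left h2F)
        rwa [zero_sub, neg_eq_zero] at h
      · have hj : j0 = true := by
          by_contra hj
          exact hG (hJ0 (by simpa using hj))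
        have ht0 : (Pi.single 0 1 : ℕ → ℕ) ∈ jIdx ℓ j0 := by
          refine ⟨fun h => by simp [hj] at h, fun q h1 _ => ?_⟩
          rw [Pi.single_eq_of_ne (by omega)]
        have hdt : dd F ℓ Γ j0 0 (X F ℓ Γ j0 0 (Pi.single 0 1)) = X F ℓ Γ j0 0 0 := by
          rw [dd, pstar_X Γ.zero_mem ht0, pt_X Γ.zero_mem ht0]
          simp
        push Not at hG
        have h := hn (X F ℓ Γ j0 0 (Pi.single 0 1)) (Or.inr (Or.inr (Or.inr ⟨hG, rfl⟩))) y
        have hb := fun z => brk_zero_mono (F := F) Γ.zero_mem ht0 (by simp)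
          (fun q hq => by simp [hq]) z
        rw [hb, hb, hdt, mulA_one, mulA_one, hd0, hdd 0 (by omega), hDy, sub_self,
          mulA_zero_right, smul_zero, sub_zero, map_zero, zero_sub, neg_eq_zero] at h
        exact h
    rw [hD, ← sub_smul, smul_eq_zero] at hfin
    refine hfin.resolve_left ?_
    norm_num
  · have hm2 : (Pi.single 0 (-2 : F) : ℕ → F) ∈ Γ := by
      rw [Pi.single_neg]
      exact Γ.neg_mem (h20 hG)
    set y := X F ℓ Γ j0 (Pi.single 0 (-2 : F)) 0 with hydef
    have hdd : ∀ q, q ≠ 0 → dd F ℓ Γ j0 q y = 0 := by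
      intro q hq
      rw [hydef, dd, pstar_X hm2 jIdx_zero, pt_X hm2 jIdx_zero]
      simp [hq]
    have hdd0 : dd F ℓ Γ j0 0 y = (-2 : F) • y := by
      rw [hydef, dd, pstar_X hm2 jIdx_zero, pt_X hm2 jIdx_zero]
      simp
    have hDy : Dop F ℓ Γ j0 y = 0 := by
      rw [hydef, Dop_X hm2 jIdx_zero, Finset.sum_eq_zero, zero_smul]
      intro q hq
      rw [Finset.mem_Icc] at hq
      rw [Pi.single_eq_of_ne (by omega)]
      simp
    have ha : ∀ q, 1 ≤ q → q ≤ iot ℓ 6 → brk F ℓ Γ j0 (QQ F ℓ Γ j0 q q) (d y) = 0 := by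
      intro q hq hq'
      have hbq := bar_low hq'
      rw [hn _ (a_mem hq hq'), brk_a hΓ1 hq hq', hdd (bar ℓ q) (by omega), mulA_zero_right,
        smul_zero, map_zero]
    have hw : ∀ q, 1 ≤ q → q ≤ iot ℓ 6 → brk F ℓ Γ j0 (QQ F ℓ Γ j0 q (bar ℓ q)) (d y) =
        -((0 : F) • d y) := by
      intro q hq hq'
      have hbq := bar_low hq'
      rw [hn _ (w_mem hq hq'), brk_w hΓ1 hq hq', hdd q (by omega), hdd (bar ℓ q) (by omega),
        mulA_zero_right, mulA_zero_right, sub_zero, map_zero, zero_smul, neg_zero]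
    have hD := Dop_of_eig hΓ1 hΓ2 (d y) (fun _ => (0 : F)) ha hw (fun q hq => rfl)
    rw [Finset.sum_const_zero, zero_smul] at hD
    have hd0 : dd F ℓ Γ j0 0 (d y) = (-2 : F) • d y := by
      have h := hn _ one_mem y
      rw [brk_one, brk_one, hdd0, map_smul, map_smul] at h
      exact smul_right_injective _ h2F h
    have h := hn (X F ℓ Γ j0 (Pi.single 0 (2 : F)) 0) (Or.inr (Or.inr (Or.inl ⟨hG, rfl⟩))) y
    have h1 : mulA F ℓ Γ j0 (X F ℓ Γ j0 (Pi.single 0 (2 : F)) 0) y = X F ℓ Γ j0 0 0 := by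
      rw [hydef, mulA_X_X (h20 hG) jIdx_zero hm2 jIdx_zero, ← Pi.single_add]
      simp
    rw [brk_x0 (h20 hG), brk_x0 (h20 hG), hd0, hdd0, hDy, hD, sub_zero, sub_zero, ← sub_smul,
      ← sub_smul, mulA_smul_right, mulA_smul_right, h1, map_smul, map_smul, hvan _ one_mem,
      smul_zero, smul_zero, smul_smul, smul_eq_zero] at h
    exact mulA_X_inj (h20 hG) jIdx_zero _ (h.resolve_left (by norm_num))

end
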